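/- arXiv:0809.2031 — 5 statements merged into one kernel-verified Lean document; each statement's English description precedes it below -/
import Mathlib

section
/- Let A be a factor on a complex Hilbert space H, let P be a projection belonging to A and P' a projection belonging to the commutant A'. If P∘P' = 0 then P = 0 or P' = 0. Equivalently, if both P and P' are nonzero then P∘P' ≠ 0. -/
/-- **Crossed projector theorem.** In a factor `A`, if `P` is a projection of `A` and `P'` a
projection of the commutant `A'` with `P * P' = 0`, then `P = 0` or `P' = 0`. -/
theorem factor_crossed_projections
    {H : Type*} [NormedAddCommGroup H] [InnerProductSpace ℂ H] [CompleteSpace H]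
    (A : VonNeumannAlgebra H)
    (hfactor : (A : Set (H →L[ℂ] H)) ∩ Set.centralizer (A : Set (H →L[ℂ] H))
      = {T : H →L[ℂ] H | ∃ c : ℂ, T = c • 1})
    (P P' : H →L[ℂ] H) (hP : P ∈ A) (hP' : P' ∈ Set.centralizer (A : Set (H →L[ℂ] H)))
    (hPsa : P = star P) (hPidem : P * P = P)
    (hP'sa : P' = star P') (hP'idem : P' * P' = P')
    (hzero : P * P' = 0) :
    P = 0 ∨ P' = 0 := by
  by_cases h0 : P' = 0
  · exact Or.inr h0
  left
  let K : Submodule ℂ H := ⨅ T : A, LinearMap.ker ((P * (T : H →L[ℂ] H) : H →L[ℂ] H) : H →ₗ[ℂ] H)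
  have hK : ∀ x, x ∈ K ↔ ∀ T ∈ A, P (T x) = 0 := by
    intro x
    simp [K, Submodule.mem_iInf]
  have hKc : IsClosed (K : Set H) := by
    have : (K : Set H) = ⋂ T : A, {x | P ((T : H →L[ℂ] H) x) = 0} := by
      ext x
      simp [hK]
    rw [this]
    exact isClosed_iInter fun T => isClosed_eq (by fun_prop) continuous_const
  haveI : CompleteSpace K := hKc.completeSpace_coe
  have hQ : IsStarProjection K.starProjection := isStarProjection_starProjection
  have hQA : K.starProjection ∈ A := by
    rw [VonNeumannAlgebra.IsStarProjection.mem_iff hQ]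
    intro y hy
    rw [VonNeumannAlgebra.mem_commutant_iff] at hy
    rw [Submodule.range_starProjection, Module.End.mem_invtSubmodule]
    intro x hx
    rw [hK] at hx
    change y x ∈ K
    rw [hK]
    intro T hT
    have h1 := DFunLike.congr_fun (hy T hT) x
    have h2 := DFunLike.congr_fun (hy P hP) (T x)
    simp only [ContinuousLinearMap.mul_apply] at h1 h2
    rw [h1, h2, hx T hT, map_zero]
  have hQA' : K.starProjection ∈ A.commutant := by
    rw [VonNeumannAlgebra.IsStarProjection.mem_iff hQ, VonNeumannAlgebra.commutant_commutant]
    intro y hy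
    rw [Submodule.range_starProjection, Module.End.mem_invtSubmodule]
    intro x hx
    rw [hK] at hx
    change y x ∈ K
    rw [hK]
    intro T hT
    exact hx (T * y) (mul_mem hT hy)
  have hc : K.starProjection ∈ {T : H →L[ℂ] H | ∃ c : ℂ, T = c • 1} := by
    rw [← hfactor]
    exact ⟨hQA, by rw [← VonNeumannAlgebra.coe_commutant]; exact hQA'⟩
  obtain ⟨c, hc⟩ := hc
  obtain ⟨x, hx⟩ : ∃ x, P' x ≠ 0 := by
    by_contra! h
    exact h0 (ContinuousLinearMap.ext h)
  have hxK : P' x ∈ K := by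
    rw [hK]
    intro T hT
    have h1 := DFunLike.congr_fun (hP' T hT) x
    have h2 := DFunLike.congr_fun hzero (T x)
    simp only [ContinuousLinearMap.mul_apply] at h1 h2
    rw [h1, h2]
    rfl
  have hc0 : c ≠ 0 := by
    rintro rfl
    have h := Submodule.starProjection_eq_self_iff.mpr hxK
    rw [hc] at h
    exact hx (by simpa using h.symm)
  ext y
  have hy : K.starProjection (c⁻¹ • y) ∈ K := Submodule.starProjection_apply_mem K _
  rw [hc] at hy
  have hy' : y ∈ K := by simpa [smul_smul, hc0] using hy
  exact (hK y).1 hy' 1 (one_mem A)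
end

section
/- Let A be a factor on a complex Hilbert space H and let P₁, P₂ be nonzero projections belonging to A. Then P₁ and P₂ possess equivalent nonzero subprojections: there exists a nonzero operator U ∈ A such that U*U and UU* are projections satisfying (U*U)∘P₁ = U*U and (UU*)∘P₂ = UU* (i.e. U*U ≤ P₁ and UU* ≤ P₂). -/
theorem flc_ext {H : Type*} [NormedAddCommGroup H] [InnerProductSpace ℂ H] [CompleteSpace H]
    (S V W : H →L[ℂ] H) (hS : star S = S) (h : V * S = W * S)
    (hk : ∀ v, S v = 0 → V v = W v) : V = W := by
  have h1 : (V - W) * S = 0 := by rw [sub_mul, h, sub_self]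
  have hS' : ∀ x y, inner ℂ (S x) y = inner ℂ x (S y) := by
    intro x y
    conv_rhs => rw [← hS]
    rw [ContinuousLinearMap.star_eq_adjoint, ContinuousLinearMap.adjoint_inner_right]
  have h2 : S * star (V - W) = 0 := by
    have := congrArg star h1
    rwa [star_mul, hS, star_zero] at this
  -- `star (V - W)` has range in the kernel of `S`, on which `V - W` vanishes
  have h3 : (V - W) * star (V - W) = 0 := by
    ext x
    have h4 : S (star (V - W) x) = 0 := by
      have := congrArg (fun T : H →L[ℂ] H => T x) h2
      simpa using this
    have := hk _ h4
    show (V - W) (star (V - W) x) = 0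
    rw [ContinuousLinearMap.sub_apply, this, sub_self]
  have h5 := CStarRing.mul_star_self_eq_zero_iff (V - W) |>.1 h3
  exact sub_eq_zero.1 h5

theorem flc_polar {H : Type*} [NormedAddCommGroup H] [InnerProductSpace ℂ H] [CompleteSpace H]
    (X S : H →L[ℂ] H) (hS : star S = S) (h : S * S = star X * X) :
    ∃ U : H →L[ℂ] H, U * S = X ∧ ∀ v, S v = 0 → U v = 0 := by
  have hS' : ∀ x y, inner ℂ (S x) y = inner ℂ x (S y) := by
    intro x y
    conv_rhs => rw [← hS]
    rw [ContinuousLinearMap.star_eq_adjoint, ContinuousLinearMap.adjoint_inner_right]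
  have hnorm : ∀ x, ‖X x‖ = ‖S x‖ := by
    intro x
    have h1 : inner ℂ (S x) (S x) = inner ℂ (X x) (X x) := by
      rw [hS']
      have : S (S x) = star X (X x) := congrArg (fun T : H →L[ℂ] H => T x) h
      rw [this, ContinuousLinearMap.star_eq_adjoint, ContinuousLinearMap.adjoint_inner_right]
    rw [@norm_eq_sqrt_re_inner ℂ, @norm_eq_sqrt_re_inner ℂ _ _ _ _ (S x), h1]
  let K : Submodule ℂ H := S.range.topologicalClosure
  haveI : CompleteSpace K := (Submodule.isClosed_topologicalClosure _).completeSpace_coe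
  have hmem : ∀ x, S x ∈ K := fun x => Submodule.le_topologicalClosure _ ⟨x, rfl⟩
  let e : H →ₗ[ℂ] K := (S : H →ₗ[ℂ] H).codRestrict K hmem
  have hd : DenseRange e := by
    intro y
    rw [closure_subtype]
    have hy : (y : H) ∈ closure (Set.range S) := y.2
    refine closure_mono ?_ hy
    rintro _ ⟨x, rfl⟩
    exact ⟨e x, ⟨x, rfl⟩, rfl⟩
  have hb : ∀ x, ‖(X : H →ₗ[ℂ] H) x‖ ≤ 1 * ‖e x‖ := by
    intro x
    rw [one_mul]
    exact (hnorm x).le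
  refine ⟨((X : H →ₗ[ℂ] H).extendOfNorm e).comp K.orthogonalProjection, ?_, ?_⟩
  · ext x
    have h1 : K.orthogonalProjection (S x) = e x :=
      Submodule.orthogonalProjection_mem_subspace_eq_self (e x)
    show ((X : H →ₗ[ℂ] H).extendOfNorm e) (K.orthogonalProjection (S x)) = X x
    rw [h1]
    exact LinearMap.extendOfNorm_eq hd ⟨1, hb⟩ x
  · intro v hv
    have h1 : K.orthogonalProjection v = 0 := by
      rw [Submodule.orthogonalProjection_eq_zero_iff]
      rw [Submodule.orthogonal_closure, Submodule.mem_orthogonal]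
      rintro _ ⟨x, rfl⟩
      show inner ℂ (S x) v = 0
      rw [hS', hv, inner_zero_right]
    show ((X : H →ₗ[ℂ] H).extendOfNorm e) (K.orthogonalProjection v) = 0
    rw [h1, map_zero]

theorem flc_inv {H : Type*} [NormedAddCommGroup H] [InnerProductSpace ℂ H]
    (s : Set H) (B : H →L[ℂ] H) (hB : ∀ y ∈ s, B y ∈ s) :
    ∀ y ∈ (Submodule.span ℂ s).topologicalClosure,
      B y ∈ (Submodule.span ℂ s).topologicalClosure := by
  have h0 : ∀ y ∈ Submodule.span ℂ s, B y ∈ Submodule.span ℂ s := by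
    intro y hy
    have : Submodule.span ℂ s ≤ (Submodule.span ℂ s).comap (B : H →ₗ[ℂ] H) :=
      Submodule.span_le.2 fun y hy => Submodule.subset_span (hB y hy)
    exact this hy
  intro y hy
  exact map_mem_closure B.continuous hy h0

theorem flc_step {H : Type*} [NormedAddCommGroup H] [InnerProductSpace ℂ H] [CompleteSpace H]
    (A : VonNeumannAlgebra H)
    (hfactor : (A : Set (H →L[ℂ] H)) ∩ Set.centralizer (A : Set (H →L[ℂ] H))
      = {T : H →L[ℂ] H | ∃ c : ℂ, T = c • 1})
    (P₁ P₂ : H →L[ℂ] H) (hP₁ : P₁ ∈ A)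
    (hP₁ne : P₁ ≠ 0) (hP₂ne : P₂ ≠ 0) : ∃ T ∈ A, P₂ * T * P₁ ≠ 0 := by
  by_contra! hcon
  let s : Set H := {y | ∃ T ∈ A, ∃ x, y = T (P₁ x)}
  let K : Submodule ℂ H := (Submodule.span ℂ s).topologicalClosure
  haveI : CompleteSpace K := (Submodule.isClosed_topologicalClosure _).completeSpace_coe
  have hsK : ∀ y ∈ s, y ∈ K := fun y hy =>
    Submodule.le_topologicalClosure _ (Submodule.subset_span hy)
  have hstar : IsStarProjection K.starProjection := isStarProjection_starProjection
  have hA : K.starProjection ∈ A := by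
    rw [VonNeumannAlgebra.IsStarProjection.mem_iff hstar]
    intro B hB
    rw [VonNeumannAlgebra.mem_commutant_iff] at hB
    rw [Submodule.range_starProjection, Module.End.mem_invtSubmodule]
    refine flc_inv s B ?_
    rintro _ ⟨T, hT, x, rfl⟩
    refine ⟨T, hT, B x, ?_⟩
    have h1 : T (B (P₁ x)) = B (T (P₁ x)) := congrArg (fun T : H →L[ℂ] H => T (P₁ x)) (hB T hT)
    have h2 : P₁ (B x) = B (P₁ x) := congrArg (fun T : H →L[ℂ] H => T x) (hB P₁ hP₁)
    rw [h2, h1]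
  have hA' : K.starProjection ∈ A.commutant := by
    rw [VonNeumannAlgebra.IsStarProjection.mem_iff hstar]
    intro B hB
    rw [VonNeumannAlgebra.commutant_commutant] at hB
    rw [Submodule.range_starProjection, Module.End.mem_invtSubmodule]
    refine flc_inv s B ?_
    rintro _ ⟨T, hT, x, rfl⟩
    exact ⟨B * T, mul_mem hB hT, x, rfl⟩
  have hmem : K.starProjection ∈ (A : Set (H →L[ℂ] H)) ∩ Set.centralizer (A : Set (H →L[ℂ] H)) :=
    ⟨hA, by rw [← VonNeumannAlgebra.coe_commutant]; exact hA'⟩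
  rw [hfactor] at hmem
  obtain ⟨c, hc⟩ := hmem
  obtain ⟨x, hx⟩ : ∃ x, P₁ x ≠ 0 := by
    by_contra! h
    exact hP₁ne (ContinuousLinearMap.ext h)
  have hxK : P₁ x ∈ K := hsK _ ⟨1, one_mem A, x, rfl⟩
  have hc0 : c ≠ 0 := by
    rintro rfl
    have h1 := Submodule.starProjection_eq_self_iff.2 hxK
    rw [hc] at h1
    simp at h1
    exact hx h1.symm
  have htop : ∀ y, y ∈ K := by
    intro y
    have h1 : K.starProjection y ∈ K := Submodule.starProjection_apply_mem _ _
    rw [hc] at h1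
    have h2 : c • y ∈ K := by simpa using h1
    exact (Submodule.smul_mem_iff _ hc0).1 h2
  have hle : K ≤ P₂.ker := by
    refine Submodule.topologicalClosure_minimal _ (Submodule.span_le.2 ?_) P₂.isClosed_ker
    rintro _ ⟨T, hT, x, rfl⟩
    exact congrArg (fun T : H →L[ℂ] H => T x) (hcon T hT)
  exact hP₂ne (ContinuousLinearMap.ext fun y => hle (htop y))

/-- **Local comparability.** In a factor `A`, any two nonzero projections `P₁, P₂ ∈ A` possess
equivalent nonzero subprojections: there is a nonzero partial isometry `U ∈ A` with
`U* U ≤ P₁` and `U U* ≤ P₂`. -/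
theorem factor_local_comparability
    {H : Type*} [NormedAddCommGroup H] [InnerProductSpace ℂ H] [CompleteSpace H]
    (A : VonNeumannAlgebra H)
    (hfactor : (A : Set (H →L[ℂ] H)) ∩ Set.centralizer (A : Set (H →L[ℂ] H))
      = {T : H →L[ℂ] H | ∃ c : ℂ, T = c • 1})
    (P₁ P₂ : H →L[ℂ] H) (hP₁ : P₁ ∈ A) (hP₂ : P₂ ∈ A)
    (hP₁sa : P₁ = star P₁) (hP₁idem : P₁ * P₁ = P₁)
    (hP₂sa : P₂ = star P₂) (hP₂idem : P₂ * P₂ = P₂)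
    (hP₁ne : P₁ ≠ 0) (hP₂ne : P₂ ≠ 0) :
    ∃ U : H →L[ℂ] H, U ∈ A ∧ U ≠ 0 ∧
      (star U * U) * (star U * U) = star U * U ∧
      (U * star U) * (U * star U) = U * star U ∧
      (star U * U) * P₁ = star U * U ∧
      (U * star U) * P₂ = U * star U := by
  obtain ⟨T, hT, hX0⟩ := flc_step A hfactor P₁ P₂ hP₁ hP₁ne hP₂ne
  obtain ⟨X, hX⟩ : ∃ X, X = P₂ * T * P₁ := ⟨_, rfl⟩
  have hXA : X ∈ A := by rw [hX]; exact mul_mem (mul_mem hP₂ hT) hP₁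
  rw [← hX] at hX0
  have hXP : X * P₁ = X := by rw [hX, mul_assoc, hP₁idem]
  have hPX : P₂ * X = X := by rw [hX, ← mul_assoc, ← mul_assoc, hP₂idem]
  obtain ⟨S, hSdef⟩ : ∃ S, S = CFC.abs X := ⟨_, rfl⟩
  have hS : star S = S := by
    rw [hSdef]; exact (IsSelfAdjoint.of_nonneg (CFC.abs_nonneg X)).star_eq
  have hSS : S * S = star X * X := by rw [hSdef]; exact CFC.abs_mul_abs X
  obtain ⟨U, hUS, hUk⟩ := flc_polar X S hS hSS
  have hXU : star X * U = S := by
    refine flc_ext S _ _ hS (by rw [mul_assoc, hUS, hSS]) ?_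
    intro v hv
    show star X (U v) = S v
    rw [hUk v hv, hv, map_zero]
  have hUX : star U * X = S := by
    have := congrArg star hXU
    rwa [star_mul, star_star, hS] at this
  have hUUU : U * star U * U = U := by
    refine flc_ext S _ _ hS (by rw [mul_assoc, hUS, mul_assoc, hUX, hUS]) ?_
    intro v hv
    show U (star U (U v)) = U v
    rw [hUk v hv, map_zero, map_zero]
  have hPS : P₁ * S = S := by
    have h1 : P₁ * star X = star X := by
      have := congrArg star hXP
      rwa [star_mul, ← hP₁sa] at this
    rw [← hXU, ← mul_assoc, h1]
  have hSP : S * P₁ = S := by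
    have := congrArg star hPS
    rwa [star_mul, ← hP₁sa, hS] at this
  have hUP : U * P₁ = U := by
    refine flc_ext S _ _ hS (by rw [mul_assoc, hPS]) ?_
    intro v hv
    have h1 : S (P₁ v) = S v := congrArg (fun T : H →L[ℂ] H => T v) hSP
    show U (P₁ v) = U v
    rw [hUk v hv, hUk _ (h1.trans hv)]
  have hPU : P₂ * U = U := by
    refine flc_ext S _ _ hS (by rw [mul_assoc, hUS, hPX]) ?_
    intro v hv
    show P₂ (U v) = U v
    rw [hUk v hv, map_zero]
  have hUP2 : star U * P₂ = star U := by
    have := congrArg star hPU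
    rwa [star_mul, ← hP₂sa] at this
  have hUA : U ∈ A := by
    rw [← VonNeumannAlgebra.commutant_commutant A, VonNeumannAlgebra.mem_commutant_iff]
    intro B hB
    have hB' := star_mem hB
    rw [VonNeumannAlgebra.mem_commutant_iff] at hB hB'
    have hSB : S * B = B * S := by
      rw [hSdef]
      exact (Commute.cfcAbs_left (a := X) (b := B) (hB X hXA) (hB' X hXA)).eq
    refine flc_ext S _ _ hS ?_ ?_
    · rw [mul_assoc, hUS, mul_assoc, ← hSB, ← mul_assoc, hUS, hB X hXA]
    · intro v hv
      have h1 : S (B v) = B (S v) := congrArg (fun T : H →L[ℂ] H => T v) hSB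
      show B (U v) = U (B v)
      rw [hUk v hv, hUk (B v) (by rw [h1, hv, map_zero]), map_zero]
  refine ⟨U, hUA, ?_, ?_, ?_, ?_, ?_⟩
  · rintro rfl
    exact hX0 (by rw [← hUS, zero_mul])
  · rw [mul_assoc, ← mul_assoc U, hUUU]
  · rw [← mul_assoc, hUUU]
  · rw [mul_assoc, hUP]
  · rw [mul_assoc, hUP2]
end

section
/- Let A be a factor on a complex Hilbert space H and let P₁, P₂ be projections belonging to A. Then P₁ and P₂ are comparable: either there exists U ∈ A with U*U = P₁ and UU* a projection satisfying UU* ≤ P₂, or there exists V ∈ A with V*V = P₂ and VV* a projection satisfying VV* ≤ P₁. -/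
open scoped InnerProductSpace

section
variable {H : Type*} [NormedAddCommGroup H] [InnerProductSpace ℂ H] [CompleteSpace H]

def cornerForms (A : VonNeumannAlgebra H) (P₁ P₂ : H →L[ℂ] H) : Set (H → H → ℂ) :=
  {f | ∃ X : H →L[ℂ] H, X ∈ A ∧ P₂ * X = X ∧ X * P₁ = X ∧ ‖X‖ ≤ 1 ∧
    f = fun x y => ⟪x, X y⟫_ℂ}

lemma cornerForms_eq (A : VonNeumannAlgebra H) (P₁ P₂ : H →L[ℂ] H) :
    cornerForms A P₁ P₂ = {f | (∀ x y, f x y ∈ Metric.closedBall (0:ℂ) (‖x‖ * ‖y‖)) ∧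
      (∀ x x' y, f (x + x') y = f x y + f x' y) ∧
      (∀ (c : ℂ) x y, f (c • x) y = star c * f x y) ∧
      (∀ x y y', f x (y + y') = f x y + f x y') ∧
      (∀ (c : ℂ) x y, f x (c • y) = c * f x y) ∧
      (∀ B : H →L[ℂ] H, B ∈ A.commutant → ∀ x y, f x (B y) = f (star B x) y) ∧
      (∀ x y, f (star P₂ x) y = f x y) ∧ (∀ x y, f x (P₁ y) = f x y)} := by
  ext f
  constructor
  · rintro ⟨X, hXA, h2, h1, hn, rfl⟩
    refine ⟨fun x y => ?_, fun x x' y => inner_add_left _ _ _, fun c x y => ?_, fun x y y' => ?_,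
      fun c x y => ?_, fun B hB x y => ?_, fun x y => ?_, fun x y => ?_⟩
    · rw [mem_closedBall_zero_iff]
      refine (norm_inner_le_norm _ _).trans ?_
      gcongr
      simpa using X.le_of_opNorm_le hn y
    · simp [mul_comm]
    · simp [inner_add_right]
    · simp [inner_smul_right]
    · have := congr($(VonNeumannAlgebra.mem_commutant_iff.1 hB X hXA) y)
      simp only [mul_apply_eq_comp] at this
      simp only [this, ContinuousLinearMap.star_eq_adjoint, ContinuousLinearMap.adjoint_inner_left]
    · have := congr($h2 y)
      simp only [mul_apply_eq_comp] at this
      simp only [ContinuousLinearMap.star_eq_adjoint, ContinuousLinearMap.adjoint_inner_left, this]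
    · have := congr($h1 y)
      simp only [mul_apply_eq_comp] at this
      simp only [this]
  · rintro ⟨hb, hal, hsl, har, hsr, hc, hp2, hp1⟩
    simp only [mem_closedBall_zero_iff] at hb
    let L : H →ₗ⋆[ℂ] H →ₗ[ℂ] ℂ := LinearMap.mk₂'ₛₗ (starRingEnd ℂ) (RingHom.id ℂ) f hal
      (fun c x y => hsl c x y) har (fun c x y => hsr c x y)
    let L' : H →L⋆[ℂ] H →L[ℂ] ℂ := L.mkContinuous₂ 1 (fun x y => by simpa [L] using hb x y)
    let Y := InnerProductSpace.continuousLinearMapOfBilin L'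
    have hY : ∀ x y, ⟪Y x, y⟫_ℂ = f x y := fun x y => by
      simp [Y, L', L]
    have hX : ∀ x y, ⟪x, (star Y) y⟫_ℂ = f x y := fun x y => by
      rw [ContinuousLinearMap.star_eq_adjoint, ContinuousLinearMap.adjoint_inner_right, hY]
    refine ⟨star Y, ?_, ?_, ?_, ?_, ?_⟩
    · rw [← A.commutant_commutant, VonNeumannAlgebra.mem_commutant_iff]
      intro B hB
      ext y
      refine ext_inner_left ℂ fun x => ?_
      simp only [mul_apply_eq_comp]
      rw [hX, hc B hB, ← hX, ContinuousLinearMap.star_eq_adjoint B,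
        ContinuousLinearMap.adjoint_inner_left]
    · ext y
      refine ext_inner_left ℂ fun x => ?_
      simp only [mul_apply_eq_comp]
      rw [← ContinuousLinearMap.adjoint_inner_left, ← ContinuousLinearMap.star_eq_adjoint, hX, hX,
        hp2]
    · ext y
      refine ext_inner_left ℂ fun x => ?_
      simp only [mul_apply_eq_comp]
      rw [hX, hX, hp1]
    · refine ContinuousLinearMap.opNorm_le_bound _ zero_le_one fun y => ?_
      have h := hb ((star Y) y) y
      rw [← hX, inner_self_eq_norm_sq_to_K] at h
      simp only [norm_pow, Complex.coe_algebraMap, Complex.norm_real, norm_norm] at h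
      rcases (norm_nonneg ((star Y) y)).eq_or_lt with h0 | h0
      · rw [← h0]; positivity
      · rw [one_mul]; rw [sq] at h; exact le_of_mul_le_mul_left h h0
    · ext x y; exact (hX x y).symm

lemma isCompact_cornerForms (A : VonNeumannAlgebra H) (P₁ P₂ : H →L[ℂ] H) :
    IsCompact (cornerForms A P₁ P₂) := by
  have hK : IsCompact {f : H → H → ℂ | ∀ x, f x ∈ {g : H → ℂ | ∀ y, g y ∈
      Metric.closedBall (0:ℂ) (‖x‖ * ‖y‖)}} :=
    isCompact_pi_infinite fun x => isCompact_pi_infinite fun y => isCompact_closedBall _ _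
  have e : ∀ x y : H, Continuous fun f : H → H → ℂ => f x y := fun x y => by fun_prop
  rw [cornerForms_eq]
  refine hK.of_isClosed_subset ?_ fun f hf => hf.1
  simp only [Set.ofPred_and, Set.ofPred_forall]
  refine IsClosed.inter ?_ <| IsClosed.inter ?_ <| IsClosed.inter ?_ <| IsClosed.inter ?_ <|
    IsClosed.inter ?_ <| IsClosed.inter ?_ <| IsClosed.inter ?_ ?_
  · exact isClosed_iInter fun x => isClosed_iInter fun y =>
      Metric.isClosed_closedBall.preimage (e x y)
  all_goals
    repeat refine isClosed_iInter fun _ => ?_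
    exact isClosed_eq (by fun_prop) (by fun_prop)

lemma exists_extreme (A : VonNeumannAlgebra H) (P₁ P₂ : H →L[ℂ] H) :
    ∃ X : H →L[ℂ] H, X ∈ A ∧ P₂ * X = X ∧ X * P₁ = X ∧ ‖X‖ ≤ 1 ∧
      ∀ B ∈ A, P₂ * B = B → B * P₁ = B → ‖X + B‖ ≤ 1 → ‖X - B‖ ≤ 1 → B = 0 := by
  obtain ⟨f, ⟨X, hX, h2, h1, hn, rfl⟩, hf⟩ :=
    (isCompact_cornerForms A P₁ P₂).extremePoints_nonempty
    ⟨_, 0, zero_mem A, by simp, by simp, by simp, rfl⟩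
  refine ⟨X, hX, h2, h1, hn, fun B hB hB2 hB1 hp hm => ?_⟩
  have := hf ⟨X + B, add_mem hX hB, by rw [mul_add, h2, hB2], by rw [add_mul, h1, hB1], hp, rfl⟩
    ⟨X - B, sub_mem hX hB, by rw [mul_sub, h2, hB2], by rw [sub_mul, h1, hB1], hm, rfl⟩
    ⟨1/2, 1/2, by norm_num, by norm_num, by norm_num, by
      ext x y
      simp [inner_add_right, inner_sub_right]
      ring⟩
  ext y
  refine ext_inner_left ℂ fun x => ?_
  have := congrFun (congrFun this x) y
  simpa [inner_add_right] using this

lemma factor_prime (A : VonNeumannAlgebra H)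
    (hfactor : (A : Set (H →L[ℂ] H)) ∩ Set.centralizer (A : Set (H →L[ℂ] H))
      = {T : H →L[ℂ] H | ∃ c : ℂ, T = c • 1})
    (Q₁ Q₂ : H →L[ℂ] H) (hQ₁ : Q₁ ∈ A) (h : ∀ T ∈ A, Q₂ * T * Q₁ = 0) :
    Q₁ = 0 ∨ Q₂ = 0 := by
  by_contra! hne
  obtain ⟨hne1, hne2⟩ := hne
  let s : Set H := {z | ∃ T ∈ A, ∃ v, z = T (Q₁ v)}
  let K : Submodule ℂ H := (Submodule.span ℂ s).topologicalClosure
  have hKc : IsClosed (K : Set H) := Submodule.isClosed_topologicalClosure _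
  haveI : CompleteSpace K := hKc.completeSpace_coe
  have hsK : ∀ z ∈ s, z ∈ K := fun z hz =>
    Submodule.le_topologicalClosure _ (Submodule.subset_span hz)
  have key : ∀ (y : H →L[ℂ] H) (M : Submodule ℂ H), IsClosed (M : Set H) →
      (∀ z ∈ s, y z ∈ M) → ∀ z ∈ K, y z ∈ M := by
    intro y M hM hy
    have : K ≤ M.comap (y : H →ₗ[ℂ] H) := by
      refine Submodule.topologicalClosure_minimal _ (Submodule.span_le.2 hy) ?_
      exact hM.preimage y.continuous
    exact this
  have hproj : IsStarProjection K.starProjection := isStarProjection_starProjection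
  have hmem : K.starProjection ∈ A := by
    rw [VonNeumannAlgebra.IsStarProjection.mem_iff hproj]
    intro y hy
    rw [Submodule.range_starProjection]
    refine key y K hKc ?_
    rintro _ ⟨T, hT, v, rfl⟩
    refine hsK _ ⟨T, hT, y v, ?_⟩
    rw [VonNeumannAlgebra.mem_commutant_iff] at hy
    have := congr($(hy _ (mul_mem hT hQ₁)) v)
    simpa using this.symm
  have hmem' : K.starProjection ∈ A.commutant := by
    rw [VonNeumannAlgebra.IsStarProjection.mem_iff hproj]
    intro y hy
    rw [VonNeumannAlgebra.commutant_commutant] at hy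
    rw [Submodule.range_starProjection]
    refine key y K hKc ?_
    rintro _ ⟨T, hT, v, rfl⟩
    exact hsK _ ⟨y * T, mul_mem hy hT, v, rfl⟩
  obtain ⟨c, hc⟩ : K.starProjection ∈ {T : H →L[ℂ] H | ∃ c : ℂ, T = c • 1} := by
    rw [← hfactor]
    refine ⟨hmem, ?_⟩
    rw [← VonNeumannAlgebra.coe_commutant]; exact hmem'
  obtain ⟨v, hv⟩ : ∃ v, Q₁ v ≠ 0 := by
    by_contra! h0
    exact hne1 (ContinuousLinearMap.ext h0)
  have hvK : Q₁ v ∈ K := hsK _ ⟨1, one_mem A, v, rfl⟩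
  have h1 := Submodule.starProjection_eq_self_iff.2 hvK
  rw [hc] at h1
  have hc1 : c = 1 := by
    have : (c - 1) • Q₁ v = 0 := by simpa [sub_smul, sub_eq_zero] using h1
    rcases smul_eq_zero.1 this with h | h
    · exact sub_eq_zero.1 h
    · exact absurd h hv
  apply hne2
  ext z
  have hz : z ∈ K := Submodule.starProjection_eq_self_iff.1 (by rw [hc, hc1]; simp)
  have := key Q₂ ⊥ (by simp) (by
    rintro _ ⟨T, hT, v, rfl⟩
    have := congr($(h T hT) v)
    simpa using this) z hz
  simpa using this


lemma norm_add_le_of_orth (X b : H →L[ℂ] H) (hX : ‖X‖ ≤ 1) (hb : ‖b‖ ≤ 1)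
    (hXa : X * (star X * X) = X) (hXb : star X * b = 0) (hba : b * (star X * X) = 0) :
    ‖X + b‖ ≤ 1 := by
  refine ContinuousLinearMap.opNorm_le_bound _ zero_le_one fun v => ?_
  rw [one_mul]
  refine le_of_sq_le_sq ?_ (norm_nonneg v)
  set a := star X * X with ha
  have haa : a * a = a := by rw [ha, mul_assoc, ← ha, hXa]
  have hsa : star a = a := by simp [ha]
  have o1 : ⟪X v, b v⟫_ℂ = 0 := by
    have := congr($hXb v)
    rw [← ContinuousLinearMap.adjoint_inner_right, ← ContinuousLinearMap.star_eq_adjoint]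
    simp only [mul_apply_eq_comp] at this
    simp [this]
  have o2 : ⟪a v, v - a v⟫_ℂ = 0 := by
    have := congr($haa v)
    simp only [mul_apply_eq_comp] at this
    rw [← ContinuousLinearMap.adjoint_inner_right, ← ContinuousLinearMap.star_eq_adjoint, hsa,
      map_sub, this]
    simp
  have p1 := norm_add_sq_eq_norm_sq_add_norm_sq_of_inner_eq_zero (X v) (b v) o1
  have p2 := norm_add_sq_eq_norm_sq_add_norm_sq_of_inner_eq_zero (a v) (v - a v) o2
  rw [add_sub_cancel] at p2
  have e1 : X (a v) = X v := by simpa using congr($hXa v)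
  have e2 : b (v - a v) = b v := by
    have := congr($hba v)
    simp only [mul_apply_eq_comp] at this
    simp [this]
  have n1 : ‖X v‖ ≤ ‖a v‖ := by
    rw [← e1]; simpa using X.le_of_opNorm_le hX (a v)
  have n2 : ‖b v‖ ≤ ‖v - a v‖ := by
    rw [← e2]; simpa using b.le_of_opNorm_le hb (v - a v)
  rw [ContinuousLinearMap.add_apply]
  nlinarith [norm_nonneg (X v), norm_nonneg (b v)]

lemma norm_three_sub_le (X : H →L[ℂ] H) (hX : ‖X‖ ≤ 1) :
    ‖3 * X - X * (star X * X)‖ ≤ 2 := by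
  refine ContinuousLinearMap.opNorm_le_bound _ zero_le_two fun v => ?_
  refine le_of_sq_le_sq ?_ (by positivity)
  set Y := 3 * X - X * (star X * X) with hY
  set W := 1 - star X * X with hW
  have id1 : star Y * Y + 4 * (star W * W) = 4 * 1 + star (X * W) * (X * W) := by
    have h3 : star (3 : H →L[ℂ] H) = 3 := by simpa using star_natCast (R := H →L[ℂ] H) 3
    simp only [hY, hW, star_sub, star_mul, star_star, star_one, h3]
    noncomm_ring
  have hs : ∀ Z : H →L[ℂ] H, ⟪(star Z * Z) v, v⟫_ℂ = (‖Z v‖ : ℂ) ^ 2 := fun Z => by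
    rw [mul_apply_eq_comp, ContinuousLinearMap.star_eq_adjoint,
      ContinuousLinearMap.adjoint_inner_left, inner_self_eq_norm_sq_to_K]
    rfl
  have h4 : (4 : H →L[ℂ] H) = (4 : ℂ) • 1 :=
    (map_ofNat (algebraMap ℂ (H →L[ℂ] H)) 4).symm.trans (Algebra.algebraMap_eq_smul_one 4)
  have := congr(⟪$id1 v, v⟫_ℂ)
  rw [h4] at this
  simp only [ContinuousLinearMap.add_apply, inner_add_left, smul_mul_assoc, one_mul,
    ContinuousLinearMap.smul_apply, inner_smul_left, hs, one_apply_eq_self,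
    inner_self_eq_norm_sq_to_K] at this
  have h5 : ‖Y v‖ ^ 2 + 4 * ‖W v‖ ^ 2 = 4 * ‖v‖ ^ 2 + ‖(X * W) v‖ ^ 2 := by
    have h7 : (starRingEnd ℂ) 4 = 4 := map_ofNat _ 4
    rw [h7] at this
    simp only [Complex.coe_algebraMap] at this
    exact_mod_cast this
  have h6 : ‖(X * W) v‖ ≤ ‖W v‖ := by
    rw [mul_apply_eq_comp]; simpa using X.le_of_opNorm_le hX (W v)
  nlinarith [norm_nonneg ((X * W) v), norm_nonneg (W v)]

lemma exists_pisom (A : VonNeumannAlgebra H) (P₁ P₂ : H →L[ℂ] H) (hP₁ : P₁ ∈ A) (hP₂ : P₂ ∈ A)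
    (hP₁sa : P₁ = star P₁) (hP₁idem : P₁ * P₁ = P₁)
    (hP₂sa : P₂ = star P₂) (hP₂idem : P₂ * P₂ = P₂) :
    ∃ X ∈ A, P₂ * X = X ∧ X * P₁ = X ∧ X * (star X * X) = X ∧
      ∀ T ∈ A, (P₂ - X * star X) * T * (P₁ - star X * X) = 0 := by
  obtain ⟨X, hX, h2, h1, hn, hext⟩ := exists_extreme A P₁ P₂
  have smulA : ∀ (c : ℂ) {T : H →L[ℂ] H}, T ∈ A → c • T ∈ A := fun c T hT =>
    A.toStarSubalgebra.smul_mem hT c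
  have haA : star X * X ∈ A := mul_mem (star_mem hX) hX
  have hX2 : star X * P₂ = star X := by
    have := congr(star $h2); rwa [star_mul, ← hP₂sa] at this
  have hX1 : P₁ * star X = star X := by
    have := congr(star $h1); rwa [star_mul, ← hP₁sa] at this
  have hXa : X * (star X * X) = X := by
    have hXan : ‖X * (star X * X)‖ ≤ 1 := by
      refine (norm_mul_le _ _).trans (mul_le_one₀ hn (norm_nonneg _) ?_)
      refine (norm_mul_le _ _).trans (mul_le_one₀ ?_ (norm_nonneg _) hn)
      rwa [norm_star]
    have h3 : (3 : H →L[ℂ] H) * X = (3 : ℂ) • X := by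
      have h3' : (3 : H →L[ℂ] H) = (3 : ℂ) • 1 :=
        (map_ofNat (algebraMap ℂ (H →L[ℂ] H)) 3).symm.trans (Algebra.algebraMap_eq_smul_one 3)
      rw [h3', smul_mul_assoc, one_mul]
    have := hext ((1/2 : ℂ) • (X - X * (star X * X)))
      (smulA _ (sub_mem hX (mul_mem hX haA)))
      (by rw [mul_smul_comm, mul_sub, ← mul_assoc, h2])
      (by rw [smul_mul_assoc, sub_mul, mul_assoc, mul_assoc, h1])
      (by
        have e : X + (1/2 : ℂ) • (X - X * (star X * X))
            = (1/2 : ℂ) • (3 * X - X * (star X * X)) := by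
          rw [h3]; module
        rw [e, norm_smul]
        have := norm_three_sub_le X hn
        norm_num
        linarith)
      (by
        have e : X - (1/2 : ℂ) • (X - X * (star X * X))
            = (1/2 : ℂ) • (X + X * (star X * X)) := by module
        rw [e, norm_smul]
        have := norm_add_le X (X * (star X * X))
        norm_num
        linarith)
    rw [smul_eq_zero_iff_right (by norm_num)] at this
    exact (sub_eq_zero.1 this).symm
  have hXs : star X * X * star X = star X := by
    have := congr(star $hXa)
    simpa using this
  refine ⟨X, hX, h2, h1, hXa, fun T hT => ?_⟩
  set b := (P₂ - X * star X) * T * (P₁ - star X * X) with hb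
  have hbA : b ∈ A := mul_mem (mul_mem (sub_mem hP₂ (mul_mem hX (star_mem hX))) hT)
    (sub_mem hP₁ haA)
  have b2 : P₂ * b = b := by
    rw [hb, ← mul_assoc, ← mul_assoc, mul_sub P₂, hP₂idem, ← mul_assoc, h2]
  have b1 : b * P₁ = b := by
    rw [hb, mul_assoc, sub_mul P₁, hP₁idem, mul_assoc (star X), h1]
  have bX : star X * b = 0 := by
    rw [hb, ← mul_assoc, ← mul_assoc, mul_sub (star X), hX2, ← mul_assoc, hXs]
    simp
  have ba : b * (star X * X) = 0 := by
    rw [hb, mul_assoc, sub_mul P₁, ← mul_assoc P₁, hX1, mul_assoc (star X), hXa]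
    simp
  let c : ℂ := ((‖b‖ + 1)⁻¹ : ℝ)
  have hc : c ≠ 0 := by
    have : (‖b‖ + 1)⁻¹ ≠ 0 := by positivity
    exact Complex.ofReal_ne_zero.2 this
  have hcn : ‖c • b‖ ≤ 1 := by
    rw [norm_smul, Complex.norm_real, Real.norm_of_nonneg (by positivity), inv_mul_le_iff₀
      (by positivity)]
    linarith
  have := hext (c • b) (smulA c hbA) (by rw [mul_smul_comm, b2]) (by rw [smul_mul_assoc, b1])
    (norm_add_le_of_orth X _ hn hcn hXa (by rw [mul_smul_comm, bX, smul_zero])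
      (by rw [smul_mul_assoc, ba, smul_zero]))
    (by
      rw [sub_eq_add_neg, ← neg_smul]
      exact norm_add_le_of_orth X _ hn (by rwa [neg_smul, norm_neg]) hXa
        (by rw [mul_smul_comm, bX, smul_zero]) (by rw [smul_mul_assoc, ba, smul_zero]))
  exact (smul_eq_zero_iff_right hc).1 this

end

/-- **First comparability theorem.** Any two projections `P₁, P₂` of a factor `A` are
comparable: either `P₁` is equivalent in `A` to a subprojection of `P₂`, or `P₂` is equivalent
in `A` to a subprojection of `P₁`. -/
theorem factor_comparability
    {H : Type*} [NormedAddCommGroup H] [InnerProductSpace ℂ H] [CompleteSpace H]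
    (A : VonNeumannAlgebra H)
    (hfactor : (A : Set (H →L[ℂ] H)) ∩ Set.centralizer (A : Set (H →L[ℂ] H))
      = {T : H →L[ℂ] H | ∃ c : ℂ, T = c • 1})
    (P₁ P₂ : H →L[ℂ] H) (hP₁ : P₁ ∈ A) (hP₂ : P₂ ∈ A)
    (hP₁sa : P₁ = star P₁) (hP₁idem : P₁ * P₁ = P₁)
    (hP₂sa : P₂ = star P₂) (hP₂idem : P₂ * P₂ = P₂) :
    (∃ U : H →L[ℂ] H, U ∈ A ∧ star U * U = P₁ ∧
      (U * star U) * (U * star U) = U * star U ∧ (U * star U) * P₂ = U * star U) ∨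
    (∃ V : H →L[ℂ] H, V ∈ A ∧ star V * V = P₂ ∧
      (V * star V) * (V * star V) = V * star V ∧ (V * star V) * P₁ = V * star V) := by
  obtain ⟨X, hX, h2, h1, hXa, hT⟩ := exists_pisom A P₁ P₂ hP₁ hP₂ hP₁sa hP₁idem hP₂sa hP₂idem
  have hX2 : star X * P₂ = star X := by
    have := congr(star $h2); rwa [star_mul, ← hP₂sa] at this
  have haA : star X * X ∈ A := mul_mem (star_mem hX) hX
  rcases factor_prime A hfactor _ _ (sub_mem hP₁ haA) hT with h | h
  · refine Or.inl ⟨X, hX, (sub_eq_zero.1 h).symm, ?_, ?_⟩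
    · rw [← mul_assoc, mul_assoc X, hXa]
    · rw [mul_assoc, hX2]
  · refine Or.inr ⟨star X, star_mem hX, ?_, ?_, ?_⟩
    · rw [star_star]; exact (sub_eq_zero.1 h).symm
    · rw [star_star, mul_assoc, hXa]
    · rw [star_star, mul_assoc, h1]
end

section
/- Let A be a von Neumann algebra on a complex Hilbert space H and let P, Q be projections belonging to A. Suppose P ≼ Q and Q ≼ P, i.e. there exist U, V ∈ A such that U*U = P, UU* is a projection with UU* ≤ Q, and V*V = Q, VV* is a projection with VV* ≤ P. Then P and Q are equivalent: there exists W ∈ A with W*W = P and WW* = Q. -/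
theorem SB.alg {R : Type*} [Ring R] [StarRing R] (P Q U V E : R)
    (hP : star P = P) (hQ : star Q = Q) (hE : star E = E) (hPP : P * P = P) (hEE : E * E = E)
    (hU : star U * U = P) (hV : star V * V = Q)
    (hUP : U * P = U) (hVQ : V * Q = V) (hQU : Q * U = U) (hPV : P * V = V)
    (hEP : E * P = E)
    (hfix : E = P - V * star V + (V * U) * E * star (V * U))
    (hinv : E * (V * U) * E = (V * U) * E)
    (hR : E * (P - V * star V) = P - V * star V) :
    star (U * E + star V * (P - E)) * (U * E + star V * (P - E)) = P ∧
    (U * E + star V * (P - E)) * star (U * E + star V * (P - E)) = Q := by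
  have hPE : P * E = E := by simpa [hP, hE] using congr(star $hEP)
  have h1 : E * star U * star V * (P - E) = 0 := by
    have : (P - E) * (V * U) * E = 0 := by
      rw [sub_mul, sub_mul, hinv, ← mul_assoc, hPV, sub_self]
    simpa [hP, hE, mul_assoc] using congr(star $this)
  have h2 : (P - E) * V * U * E = 0 := by
    rw [sub_mul, sub_mul, sub_mul, hPV, mul_assoc E V U, hinv, sub_self]
  have h3 : (P - E) * V * star V * (P - E) = P - E := by
    have : (P - E) * V * star V = P - E := by
      have h : (P - E) * (P - V * star V) = 0 := by
        rw [sub_mul, hR, mul_sub, hPP, ← mul_assoc, hPV, sub_self]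
      have h' : (P - E) * P = P - E := by rw [sub_mul, hPP, hEP]
      rw [mul_sub, h', sub_eq_zero] at h
      rw [mul_assoc, ← h]
    rw [this, sub_mul, mul_sub, mul_sub, hPP, hPE, hEP, hEE]; abel
  have h4 : E * (P - E) = 0 := by rw [mul_sub, hEP, hEE, sub_self]
  have h4' : (P - E) * E = 0 := by rw [sub_mul, hPE, hEE, sub_self]
  have h5 : (P - E) * (P - E) = P - E := by rw [mul_sub, h4', sub_zero, sub_mul, hPP, hEP]
  have h6 : star V * (P - E) * V = Q - U * E * star U := by
    have e : P - E = V * star V - (V * U) * E * star (V * U) := by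
      conv_lhs => rw [hfix]
      abel
    have hUQ : star U * Q = star U := by simpa [hQ] using congr(star $hQU)
    have hQQ : Q * Q = Q := by rw [← hV, mul_assoc (star V), hV, hVQ, hV]
    rw [e, star_mul]
    calc _ = (star V * V) * (star V * V)
          - (star V * V) * U * E * (star U * (star V * V)) := by noncomm_ring
      _ = _ := by rw [hV, hUQ, hQU, hQQ]
  simp only [star_add, star_mul, star_sub, star_star, hP, hE]
  constructor
  · calc _ = E * (star U * U) * E + E * star U * star V * (P - E) + (P - E) * V * U * E
          + (P - E) * V * star V * (P - E) := by noncomm_ring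
      _ = P := by rw [h1, h2, h3, hU, hEP, hEE]; abel
  · calc _ = U * (E * E) * star U + U * (E * (P - E)) * V + star V * ((P - E) * E) * star U
          + star V * ((P - E) * (P - E)) * V := by noncomm_ring
      _ = Q := by rw [h4, h4', h5, h6, hEE]; simp

theorem SB.mulproj {H : Type*} [NormedAddCommGroup H] [InnerProductSpace ℂ H] [CompleteSpace H]
    (P U : H →L[ℂ] H) (hP : star P = P) (hPP : P * P = P) (hU : star U * U = P) : U * P = U := by
  have : star (U * P - U) * (U * P - U) = 0 := by
    calc _ = P * (star U * U) * P - P * (star U * U) - (star U * U) * P + star U * U := by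
            simp only [star_sub, star_mul, hP]; noncomm_ring
      _ = 0 := by rw [hU, hPP, hPP]; abel
  exact sub_eq_zero.mp ((CStarRing.star_mul_self_eq_zero_iff _).mp this)

/-- Smallest closed `T`-invariant subspace containing the range of `R`. -/
theorem SB.exists_proj {H : Type*} [NormedAddCommGroup H] [InnerProductSpace ℂ H] [CompleteSpace H]
    (A : VonNeumannAlgebra H) (R T : H →L[ℂ] H) (hR : R ∈ A) (hT : T ∈ A) :
    ∃ E : H →L[ℂ] H, E ∈ A ∧ star E = E ∧ E * E = E ∧ E * R = R ∧ E * T * E = T * E ∧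
      ∀ G : H →L[ℂ] H, G * R = R → (∀ x, G x = x → G (T x) = T x) → G * E = E := by
  let F : Set (Submodule ℂ H) :=
    {S | IsClosed (S : Set H) ∧ (∀ x, R x ∈ S) ∧ ∀ x ∈ S, T x ∈ S}
  let K : Submodule ℂ H := sInf F
  have hmem : ∀ x, x ∈ K ↔ ∀ S ∈ F, x ∈ S := fun x => Submodule.mem_sInf
  have hcl : IsClosed (K : Set H) := by
    simp only [K, Submodule.coe_sInf]
    exact isClosed_biInter fun S hS => hS.1
  have hKR : ∀ x, R x ∈ K := fun x => (hmem _).2 fun S hS => hS.2.1 x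
  have hKT : ∀ x ∈ K, T x ∈ K := fun x hx => (hmem _).2 fun S hS => hS.2.2 x ((hmem x).1 hx S hS)
  have : CompleteSpace K := hcl.completeSpace_coe
  have hE : IsStarProjection K.starProjection := isStarProjection_starProjection
  have hfx : ∀ x ∈ K, K.starProjection x = x := fun x hx =>
    Submodule.starProjection_eq_self_iff.2 hx
  have hin : ∀ x, K.starProjection x ∈ K := fun x => Submodule.starProjection_apply_mem K x
  refine ⟨K.starProjection, ?_, hE.isSelfAdjoint, hE.isIdempotentElem, ?_, ?_, ?_⟩
  · rw [VonNeumannAlgebra.IsStarProjection.mem_iff hE]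
    intro y hy
    rw [VonNeumannAlgebra.mem_commutant_iff] at hy
    have hr : K.starProjection.range = K := by simp
    rw [hr, Module.End.mem_invtSubmodule]
    refine sInf_le (⟨?_, ?_, ?_⟩ : _ ∈ F)
    · exact hcl.preimage y.continuous
    · intro x
      have := congr($(hy R hR) x)
      change y (R x) ∈ K
      change R (y x) = y (R x) at this
      rw [← this]; exact hKR _
    · intro x hx
      have := congr($(hy T hT) x)
      change y (T x) ∈ K
      change T (y x) = y (T x) at this
      rw [← this]; exact hKT _ hx
  · ext x; exact hfx _ (hKR x)
  · ext x; exact hfx _ (hKT _ (hin x))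
  · intro G hGR hGT
    have hle : K ≤ ((G - 1 : H →L[ℂ] H)).ker := by
      refine sInf_le (⟨?_, ?_, ?_⟩ : _ ∈ F)
      · exact (G - 1).isClosed_ker
      · intro x
        have := congr($hGR x)
        change G (R x) = R x at this
        simp [this]
      · intro x hx
        have : G x = x := by simpa [sub_eq_zero] using hx
        simp [hGT x this]
    ext x
    have := hle (hin x)
    have : G (K.starProjection x) - K.starProjection x = 0 := this
    exact sub_eq_zero.1 this

/-- **Schröder–Bernstein for projections.** If `P` and `Q` are projections of a von Neumann
algebra `A` with `P ≼ Q` and `Q ≼ P`, then `P` and `Q` are equivalent in `A`. -/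
theorem projection_schroeder_bernstein
    {H : Type*} [NormedAddCommGroup H] [InnerProductSpace ℂ H] [CompleteSpace H]
    (A : VonNeumannAlgebra H)
    (P Q : H →L[ℂ] H) (hP : P ∈ A) (hQ : Q ∈ A)
    (hPsa : P = star P) (hPidem : P * P = P)
    (hQsa : Q = star Q) (hQidem : Q * Q = Q)
    (hPQ : ∃ U : H →L[ℂ] H, U ∈ A ∧ star U * U = P ∧
      (U * star U) * (U * star U) = U * star U ∧ (U * star U) * Q = U * star U)
    (hQP : ∃ V : H →L[ℂ] H, V ∈ A ∧ star V * V = Q ∧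
      (V * star V) * (V * star V) = V * star V ∧ (V * star V) * P = V * star V) :
    ∃ W : H →L[ℂ] H, W ∈ A ∧ star W * W = P ∧ W * star W = Q := by
  obtain ⟨U, hUA, hU, -, hUQ⟩ := hPQ
  obtain ⟨V, hVA, hV, -, hVP⟩ := hQP
  have hUP := SB.mulproj P U hPsa.symm hPidem hU
  have hVQ := SB.mulproj Q V hQsa.symm hQidem hV
  have hQU : Q * U = U := by
    have := congr(star $hUQ)
    simp only [star_mul, star_star, ← hQsa] at this
    calc Q * U = Q * (U * star U) * U := by rw [mul_assoc, mul_assoc, hU, hUP]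
      _ = U := by rw [this, mul_assoc, hU, hUP]
  have hPV : P * V = V := by
    have := congr(star $hVP)
    simp only [star_mul, star_star, ← hPsa] at this
    calc P * V = P * (V * star V) * V := by rw [mul_assoc, mul_assoc, hV, hVQ]
      _ = V := by rw [this, mul_assoc, hV, hVQ]
  have hVA' : star V ∈ A := star_mem hVA
  obtain ⟨E, hEA, hEs, hEE, hER, hET, hmin⟩ := SB.exists_proj A (P - V * star V) (V * U)
    (sub_mem hP (mul_mem hVA hVA')) (mul_mem hVA hUA)
  have hRs : star (P - V * star V) = P - V * star V := by simp [← hPsa]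
  have hRV : (P - V * star V) * V = 0 := by rw [sub_mul, hPV, mul_assoc, hV, hVQ, sub_self]
  have hVR : star V * (P - V * star V) = 0 := by
    have := congr(star $hRV)
    rwa [star_mul, hRs, star_zero] at this
  have hRP : (P - V * star V) * P = P - V * star V := by rw [sub_mul, hPidem, hVP]
  have hPR : P * (P - V * star V) = P - V * star V := by
    have := congr(star $hRP)
    rwa [star_mul, hRs, ← hPsa] at this
  have hRR : (P - V * star V) * (P - V * star V) = P - V * star V := by
    rw [mul_sub]
    rw [hRP, ← mul_assoc, hRV, zero_mul, sub_zero]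
  have hPE : P * E = E := by
    refine hmin P hPR fun x _ => ?_
    have : P * (V * U) = V * U := by rw [← mul_assoc, hPV]
    exact congr($this x)
  have hEP : E * P = E := by
    have := congr(star $hPE)
    rwa [star_mul, hEs, ← hPsa] at this
  have hTT : star (V * U) * (V * U) = P := by
    calc _ = star U * ((star V * V) * U) := by rw [star_mul]; noncomm_ring
      _ = P := by rw [hV, hQU, hU]
  have hfix : E = P - V * star V + (V * U) * E * star (V * U) := by
    generalize hG : P - V * star V + (V * U) * E * star (V * U) = G
    have hGs : star G = G := by
      rw [← hG, star_add, hRs]; simp [hEs, mul_assoc]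
    have hEG : E * G = G := by
      rw [← hG, mul_add, hER]
      congr 1
      rw [← mul_assoc, ← mul_assoc, hET]
    have hGE : G * E = E := by
      refine hmin G ?_ fun x hx => ?_
      · rw [← hG, add_mul, hRR, star_mul, mul_assoc, mul_assoc (star U), hVR]; simp
      · have hGT : G * (V * U) = (V * U) * E := by
          rw [← hG, add_mul, ← mul_assoc _ V U, hRV, mul_assoc _ (star (V * U)), hTT,
            mul_assoc _ E P, hEP, zero_mul, zero_add]
        have hEx : E x = x := by
          have := congr($hEG x)
          change E (G x) = G x at this
          rwa [hx] at this
        have := congr($hGT x)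
        change G ((V * U) x) = (V * U) (E x) at this
        rw [this, hEx]
    have := congr(star $hGE)
    rw [star_mul, hEs, hGs, hEG] at this
    exact this.symm
  exact ⟨U * E + star V * (P - E), add_mem (mul_mem hUA hEA) (mul_mem hVA' (sub_mem hP hEA)),
    SB.alg P Q U V E hPsa.symm hQsa.symm hEs hPidem hEE hU hV hUP hVQ hQU hPV hEP hfix hET hER⟩
end

section
/- Let (X, Σ, μ) be a σ-finite measure space and let a countable group G act on X by measurable, measure-preserving bijections, with the action ergodic. If a bounded operator T on L²(X, μ; ℂ) commutes with the multiplication operator L_{χ_S} for every measurable set S of finite measure and commutes with the composition operator U_g for every g ∈ G, then T = α·I for some α ∈ ℂ. In other words, the representation generated by the projections L_{χ_S} and the unitaries U_g is irreducible. -/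
open MeasureTheory Pointwise

theorem meas_glue_aux {X : Type*} [MeasurableSpace X] (F : ℕ → X → ℂ) (i : X → ℕ)
    (hF : ∀ n, Measurable (F n)) (hi : Measurable i) : Measurable (fun x => F (i x) x) := by
  have h : Measurable (fun p : ℕ × X => F p.1 p.2) :=
    measurable_from_prod_countable_right hF
  exact h.comp (hi.prodMk measurable_id)

/-- **Irreducibility.** For an ergodic measure-preserving action of a countable group `G` on a
σ-finite measure space, a bounded operator on `L²` commuting with all the multiplication
projections `L_{χ_S}` (`S` of finite measure) and with all the composition unitaries `U_g` is a
scalar multiple of the identity. -/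
theorem irreducibility_of_ergodic_system
    {X : Type*} [MeasurableSpace X] (μ : Measure X) [SigmaFinite μ]
    {G : Type*} [Group G] [Countable G] [MulAction G X]
    (hmeas : ∀ g : G, MeasurePreserving (fun x : X => g • x) μ μ)
    (hergodic : ∀ S : Set X, MeasurableSet S → (∀ g : G, μ (symmDiff (g • S) S) = 0) →
      μ S = 0 ∨ μ Sᶜ = 0)
    (T : Lp ℂ 2 μ →L[ℂ] Lp ℂ 2 μ)
    (hcommL : ∀ S : Set X, MeasurableSet S → μ S < ⊤ →
      ∀ f g : Lp ℂ 2 μ, ⇑g =ᵐ[μ] S.indicator ⇑f → ⇑(T g) =ᵐ[μ] S.indicator ⇑(T f))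
    (hcommU : ∀ g : G, ∀ f h : Lp ℂ 2 μ,
      ⇑h =ᵐ[μ] (fun x => f (g • x)) → ⇑(T h) =ᵐ[μ] fun x => (T f) (g • x)) :
    ∃ α : ℂ, T = α • (1 : Lp ℂ 2 μ →L[ℂ] Lp ℂ 2 μ) := by
  classical
  have hT1 : ∀ A : Set X, ∀ hA : MeasurableSet A, ∀ hf : μ A < ⊤, ∀ B : Set X,
      ∀ hB : MeasurableSet B, ∀ hfB : μ B < ⊤,
      ⇑(T (indicatorConstLp 2 (hA.inter hB)
        ((measure_mono Set.inter_subset_right).trans_lt hfB).ne (1 : ℂ)))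
        =ᵐ[μ] A.indicator ⇑(T (indicatorConstLp 2 hB hfB.ne (1 : ℂ))) := by
    intro A hA hf B hB hfB
    apply hcommL A hA hf
    filter_upwards [indicatorConstLp_coeFn (p := 2) (hs := hA.inter hB) (c := (1 : ℂ))
      (hμs := ((measure_mono Set.inter_subset_right).trans_lt hfB).ne),
      indicatorConstLp_coeFn (p := 2) (hs := hB) (hμs := hfB.ne) (c := (1 : ℂ))] with x h1 h2
    rw [h1]
    by_cases hx : x ∈ A <;> by_cases hx' : x ∈ B <;> simp [hx, hx', h2]
  let u : ℕ → Lp ℂ 2 μ := fun n => indicatorConstLp 2 (measurableSet_spanningSets μ n)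
    (measure_spanningSets_lt_top μ n).ne (1 : ℂ)
  let φ : X → ℂ := fun x => T (u (spanningSetsIndex μ x)) x
  have hφm : Measurable φ := by
    exact meas_glue_aux (fun n => ⇑(T (u n))) (spanningSetsIndex μ)
      (fun n => (Lp.stronglyMeasurable (T (u n))).measurable) (by
        refine measurable_to_countable' fun n => ?_
        rw [preimage_spanningSetsIndex_singleton]
        exact MeasurableSet.disjointed (measurableSet_spanningSets μ) n)
  have hTφ : ∀ A : Set X, ∀ hA : MeasurableSet A, ∀ hf : μ A < ⊤,
      ⇑(T (indicatorConstLp 2 hA hf.ne (1 : ℂ))) =ᵐ[μ] A.indicator φ := by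
    intro A hA hf
    have h1 := fun n => hT1 A hA hf _ (measurableSet_spanningSets μ n)
      (measure_spanningSets_lt_top μ n)
    have h2 := fun n => hT1 _ (measurableSet_spanningSets μ n)
      (measure_spanningSets_lt_top μ n) A hA hf
    filter_upwards [ae_all_iff.2 h1, ae_all_iff.2 h2] with x h1 h2
    have h1 := h1 (spanningSetsIndex μ x)
    have h2 := h2 (spanningSetsIndex μ x)
    simp only [Set.inter_comm (spanningSets μ _) A] at h2
    rw [h1, Set.indicator_of_mem (mem_spanningSetsIndex μ x)] at h2
    rw [← h2]
    by_cases hx : x ∈ A <;> simp [hx, φ, u]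
  have hinv : ∀ g : G, ∀ᵐ x ∂μ, φ (g • x) = φ x := by
    intro g
    have key : ∀ n, ∀ᵐ x ∂μ, g • x ∈ spanningSets μ n → φ (g • x) = φ x := by
      intro n
      have hS := measurableSet_spanningSets μ n
      have hfS := measure_spanningSets_lt_top μ n
      have hS' := (hmeas g).measurable hS
      have hfS' : μ ((fun x => g • x) ⁻¹' spanningSets μ n) < ⊤ := by
        rwa [(hmeas g).measure_preimage hS.nullMeasurableSet]
      have h1 := hcommU g (indicatorConstLp 2 hS hfS.ne (1 : ℂ))
        (indicatorConstLp 2 hS' hfS'.ne (1 : ℂ)) (by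
          filter_upwards [indicatorConstLp_coeFn (p := 2) (hs := hS') (hμs := hfS'.ne)
            (c := (1 : ℂ)), (hmeas g).quasiMeasurePreserving.ae
            (indicatorConstLp_coeFn (p := 2) (hs := hS) (hμs := hfS.ne)
            (c := (1 : ℂ)))] with x h1 h2
          rw [h1, h2]
          simp [Set.indicator])
      filter_upwards [h1, hTφ _ hS' hfS', (hmeas g).quasiMeasurePreserving.ae (hTφ _ hS hfS)]
        with x h1 h2 h3 hx
      rw [h2, h3, Set.indicator_of_mem hx, Set.indicator_of_mem (by exact hx)] at h1
      exact h1.symm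
    filter_upwards [ae_all_iff.2 key] with x hx
    exact hx _ (mem_spanningSetsIndex μ (g • x))
  obtain ⟨α, hα⟩ : ∃ α, φ =ᵐ[μ] Function.const X α := by
    apply Filter.exists_eventuallyEq_const_of_forall_separating MeasurableSet
    intro U hU
    have := hergodic (φ ⁻¹' U) (hφm hU) (by
      intro g
      rw [measure_symmDiff_eq_zero_iff]
      filter_upwards [hinv g⁻¹] with x hx
      apply propext
      change x ∈ g • (φ ⁻¹' U) ↔ x ∈ φ ⁻¹' U
      rw [Set.mem_smul_set_iff_inv_smul_mem, Set.mem_preimage, Set.mem_preimage, hx])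
    rcases this with h | h
    · right
      exact measure_eq_zero_iff_ae_notMem.1 h
    · left
      exact h
  refine ⟨α, ?_⟩
  ext1 f
  induction f using Lp.induction (by norm_num : (2 : ENNReal) ≠ ⊤) with
  | indicatorConst c hs hμs =>
    rename_i s
    rw [Lp.simpleFunc.coe_indicatorConst]
    have hc : indicatorConstLp 2 hs hμs.ne c = c • indicatorConstLp 2 hs hμs.ne (1 : ℂ) := by
      apply Lp.ext
      filter_upwards [Lp.coeFn_smul c (indicatorConstLp 2 hs hμs.ne (1 : ℂ)),
        indicatorConstLp_coeFn (p := 2) (hs := hs) (hμs := hμs.ne) (c := (1 : ℂ)),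
        indicatorConstLp_coeFn (p := 2) (hs := hs) (hμs := hμs.ne) (c := c)]
        with x h3 h4 h5
      rw [h5, h3, Pi.smul_apply, h4]
      by_cases hx : x ∈ s <;> simp [hx]
    have h1 : T (indicatorConstLp 2 hs hμs.ne (1 : ℂ))
        = α • indicatorConstLp 2 hs hμs.ne (1 : ℂ) := by
      apply Lp.ext
      filter_upwards [hTφ s hs hμs, hα, Lp.coeFn_smul α (indicatorConstLp 2 hs hμs.ne (1 : ℂ)),
        indicatorConstLp_coeFn (p := 2) (hs := hs) (hμs := hμs.ne) (c := (1 : ℂ))]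
        with x h1 h2 h3 h4
      rw [h1, h3, Pi.smul_apply, h4]
      by_cases hx : x ∈ s <;> simp [hx, h2]
    rw [hc, map_smul, map_smul, h1]
    simp
  | add hf hg hd h1 h2 => rw [map_add, map_add, h1, h2]
  | isClosed => exact isClosed_eq T.continuous (ContinuousLinearMap.continuous _)
end
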